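/- For every A ∈ B^{m,i} and l ∈ {1,…,n}: if e_l A ≠ 0 then wt(e_l A) = wt(A) + α_l, ε_l(e_l A) = ε_l(A) − 1 and φ_l(e_l A) = φ_l(A) + 1; if f_l A ≠ 0 then wt(f_l A) = wt(A) − α_l, ε_l(f_l A) = ε_l(A) + 1 and φ_l(f_l A) = φ_l(A) − 1. Together with the other verified axioms this makes B^{m,i} an abstract semiregular crystal of type A_n. -/

import Mathlib

open Finset

namespace KR

/-- Arrays of integers indexed by (column, row). -/
abbrev Arr := ℕ → ℕ → ℤ

/-- A Dyck path from (1,i) to (i,n). -/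
def IsDyck (n i : ℕ) (L : List (ℕ × ℕ)) : Prop :=
  L ≠ [] ∧ L.head? = some (1, i) ∧ L.getLast? = some (i, n) ∧
    L.Chain' (fun β γ => γ = (β.1, β.2 + 1) ∨ γ = (β.1 + 1, β.2))

/-- Membership in the polytope `B^{m,i}`: nonnegative entries supported on the box
`1 ≤ p ≤ i`, `i ≤ q ≤ n`, with all Dyck path sums bounded by `m`. -/
def InB (n i m : ℕ) (A : Arr) : Prop :=
  (∀ p q, 1 ≤ p → p ≤ i → i ≤ q → q ≤ n → 0 ≤ A p q) ∧
  (∀ p q, ¬(1 ≤ p ∧ p ≤ i ∧ i ≤ q ∧ q ≤ n) → A p q = 0) ∧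
  (∀ L, IsDyck n i L → (L.map fun β => A β.1 β.2).sum ≤ (m : ℤ))

/-- The sum `Σ_{j=1}^{p} a_{j,l−1} + Σ_{j=p}^{i} a_{j,l}` (used for `l > i`). -/
def Fp (i : ℕ) (A : Arr) (l p : ℕ) : ℤ :=
  ∑ j ∈ Icc 1 p, A j (l - 1) + ∑ j ∈ Icc p i, A j l

/-- `p_+^l(A)`: minimal maximizer of `Fp` on `{1,…,i}`. -/
noncomputable def pplus (i : ℕ) (A : Arr) (l : ℕ) : ℕ :=
  sInf {p | p ∈ Icc 1 i ∧ ∀ q ∈ Icc 1 i, Fp i A l q ≤ Fp i A l p}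

/-- `q_+^l(A)`: maximal maximizer of `Fp` on `{1,…,i}`. -/
noncomputable def qplus (i : ℕ) (A : Arr) (l : ℕ) : ℕ :=
  sSup {p | p ∈ Icc 1 i ∧ ∀ q ∈ Icc 1 i, Fp i A l q ≤ Fp i A l p}

/-- The sum `Σ_{j=i}^{p} a_{l,j} + Σ_{j=p}^{n} a_{l+1,j}` (used for `l < i`). -/
def Fm (n i : ℕ) (A : Arr) (l p : ℕ) : ℤ :=
  ∑ j ∈ Icc i p, A l j + ∑ j ∈ Icc p n, A (l + 1) j

/-- `p_−^l(A)`: maximal maximizer of `Fm` on `{i,…,n}`. -/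
noncomputable def pminus (n i : ℕ) (A : Arr) (l : ℕ) : ℕ :=
  sSup {p | p ∈ Icc i n ∧ ∀ q ∈ Icc i n, Fm n i A l q ≤ Fm n i A l p}

/-- `q_−^l(A)`: minimal maximizer of `Fm` on `{i,…,n}`. -/
noncomputable def qminus (n i : ℕ) (A : Arr) (l : ℕ) : ℕ :=
  sInf {p | p ∈ Icc i n ∧ ∀ q ∈ Icc i n, Fm n i A l q ≤ Fm n i A l p}

/-- `φ_l(A)` (depending on the parameter `m` only when `l = i`). -/
noncomputable def phi (n i m : ℕ) (l : ℕ) (A : Arr) : ℤ :=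
  if l = i then (m : ℤ) - ∑ j ∈ Icc 1 (i - 1), A j i - ∑ j ∈ Icc i n, A i j
  else if i < l then
    ∑ j ∈ Icc 1 (pplus i A l), A j (l - 1) - ∑ j ∈ Icc 1 (pplus i A l - 1), A j l
  else
    ∑ j ∈ Icc (pminus n i A l) n, A (l + 1) j - ∑ j ∈ Icc (pminus n i A l + 1) n, A l j

/-- `ε_l(A)` (the parameter `m` is carried along for uniformity; it is not used). -/
noncomputable def eps (n i m : ℕ) (l : ℕ) (A : Arr) : ℤ :=
  if l = i then A i i
  else if i < l then
    ∑ j ∈ Icc (qplus i A l) i, A j l - ∑ j ∈ Icc (qplus i A l + 1) i, A j (l - 1)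
  else
    ∑ j ∈ Icc i (qminus n i A l), A l j - ∑ j ∈ Icc i (qminus n i A l - 1), A (l + 1) j

/-- Update a single entry of an array. -/
def upd (A : Arr) (p q : ℕ) (v : ℤ) : Arr :=
  fun p' q' => if p' = p ∧ q' = q then v else A p' q'

/-- The Kashiwara operator `f_l` (with `none` playing the role of `0`). -/
noncomputable def fop (n i m : ℕ) (l : ℕ) (A : Arr) : Option Arr :=
  if phi n i m l A = 0 then none
  else some <|
    if l = i then upd A i i (A i i + 1)
    else if i < l then
      upd (upd A (pplus i A l) (l - 1) (A (pplus i A l) (l - 1) - 1))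
        (pplus i A l) l (A (pplus i A l) l + 1)
    else
      upd (upd A l (pminus n i A l) (A l (pminus n i A l) + 1))
        (l + 1) (pminus n i A l) (A (l + 1) (pminus n i A l) - 1)

/-- The Kashiwara operator `e_l` (with `none` playing the role of `0`). -/
noncomputable def eop (n i m : ℕ) (l : ℕ) (A : Arr) : Option Arr :=
  if eps n i m l A = 0 then none
  else some <|
    if l = i then upd A i i (A i i - 1)
    else if i < l then
      upd (upd A (qplus i A l) (l - 1) (A (qplus i A l) (l - 1) + 1))
        (qplus i A l) l (A (qplus i A l) l - 1)
    else
      upd (upd A l (qminus n i A l) (A l (qminus n i A l) - 1))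
        (l + 1) (qminus n i A l) (A (l + 1) (qminus n i A l) + 1)

/-- Coefficient of `ω_j` in the simple root `α_r` (column `r` of the Cartan matrix). -/
def cart (j r : ℕ) : ℤ :=
  if r = j then 2 else if r = j + 1 ∨ j = r + 1 then -1 else 0

/-- The weight `wt(A) = mω_i − Σ a_{p,q} α_{p,q}`, expressed in the basis of
fundamental weights: `wtv n i m A j` is the coefficient of `ω_j`. -/
def wtv (n i m : ℕ) (A : Arr) (j : ℕ) : ℤ :=
  (m : ℤ) * (if j = i then 1 else 0) -
    ∑ p ∈ Icc 1 i, ∑ q ∈ Icc i n, A p q * ∑ r ∈ Icc p q, cart j r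

/-- The coefficient `c_l(p,q)` of the pairing `⟨α_l^∨, α_{p,q}⟩`. -/
def clpq (l p q : ℕ) : ℤ :=
  if p = l ∧ q = l then 2
  else if (l = p ∧ p < q) ∨ (p < q ∧ q = l) then 1
  else if l + 1 = p ∨ l = q + 1 then -1
  else 0

/-- The pairing `⟨α_l^∨, wt(A)⟩ = m·δ_{l,i} − Σ_{p,q} a_{p,q}·c_l(p,q)`. -/
def pairing (n i m : ℕ) (l : ℕ) (A : Arr) : ℤ :=
  (m : ℤ) * (if l = i then 1 else 0) -
    ∑ p ∈ Icc 1 i, ∑ q ∈ Icc i n, A p q * clpq l p q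

/-! ### The promotion algorithm -/

/-- Columns, indexed by rows `i,…,n`. -/
abbrev Col := ℕ → ℤ

/-- `Σ_{j=lo}^{p} a_j + Σ_{j=p}^{n} b_j`. -/
def Gc (n lo : ℕ) (a b : Col) (p : ℕ) : ℤ := ∑ j ∈ Icc lo p, a j + ∑ j ∈ Icc p n, b j

/-- `q_−` for two (truncated) columns with rows `lo,…,n`: the minimal maximizer of `Gc`. -/
noncomputable def qmc (n lo : ℕ) (a b : Col) : ℕ :=
  if lo ≤ n then
    max lo (sInf {p | p ∈ Icc lo n ∧ ∀ q ∈ Icc lo n, Gc n lo a b q ≤ Gc n lo a b p})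
  else n

/-- `ε` for two (truncated) columns with rows `lo,…,n`. -/
noncomputable def epsc (n lo : ℕ) (a b : Col) : ℤ :=
  ∑ j ∈ Icc lo (qmc n lo a b), a j - ∑ j ∈ Icc lo (qmc n lo a b - 1), b j

/-- The sequence `l_1 < l_2 < ⋯` of the promotion algorithm:
`l_1 = q_−(a,c)` and `l_{s+1} = q_−((a)^{≥ l_s + 1}, (c)^{≥ l_s + 1})`,
stabilizing at `n`. -/
noncomputable def lfun (n i : ℕ) (a c : Col) : ℕ → ℕ
  | 0 => qmc n i a c
  | s + 1 => qmc n (lfun n i a c s + 1) a c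

/-- The set `{l_1, …, l_t}` (with `l_t = n`). -/
noncomputable def lset (n i : ℕ) (a c : Col) : Finset ℕ := (Finset.range (n + 1)).image (lfun n i a c)

/-- The new column `ĉ` of formula (6.2). -/
noncomputable def hatc (n i : ℕ) (a c : Col) : Col := fun r =>
  if r = n then a n + c n
  else if r ∈ lset n i a c then a r + c r - epsc n (r + 1) a c
  else a r

/-- The output column of one step of the promotion algorithm. -/
noncomputable def prcol (n i : ℕ) (a c : Col) : Col := fun r =>
  if r = i then epsc n i a c
  else if r - 1 ∈ lset n i a c then epsc n r a c
  else c (r - 1)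

/-- The running columns of the promotion algorithm: `cseq 0` is the `i`-th column of `A`,
and `cseq (k+1)` is obtained from the `(i−1−k)`-th column of `A` and `cseq k`. -/
noncomputable def cseq (n i : ℕ) (A : Arr) : ℕ → Col
  | 0 => fun r => A i r
  | k + 1 => hatc n i (fun r => A (i - 1 - k) r) (cseq n i A k)

/-- The `j`-th column of `pr(A)` for `2 ≤ j ≤ i`. -/
noncomputable def prColJ (n i : ℕ) (A : Arr) (j : ℕ) : Col :=
  prcol n i (fun q => A (j - 1) q) (cseq n i A (i - j))

/-- The promotion map `pr` on `B^{m,i}`. -/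
noncomputable def prMap (n i m : ℕ) (A : Arr) : Arr := fun p r =>
  if 1 ≤ p ∧ p ≤ i ∧ i ≤ r ∧ r ≤ n then
    if p = 1 then
      if r = i then
        (m : ℤ) - (∑ j ∈ Icc i n, A i j) - ∑ j ∈ Icc 2 i, prColJ n i A j i
      else
        (∑ j ∈ Icc 1 i, A j (r - 1)) - ∑ j ∈ Icc 2 i, prColJ n i A j r
    else prColJ n i A p r
  else 0

/-- The content `(r_1,…,r_{n+1})` of an array. -/
def cont (n i m : ℕ) (A : Arr) (k : ℕ) : ℤ :=
  if k ≤ i then (m : ℤ) - ∑ q ∈ Icc i n, A k q else ∑ p ∈ Icc 1 i, A p (k - 1)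

/-! ### Maximizers of path sums -/

/-- The points of `{lo,…,hi}` at which `F` is maximal. -/
def maximizers (lo hi : ℕ) (F : ℕ → ℤ) : Set ℕ :=
  {p | p ∈ Icc lo hi ∧ ∀ q ∈ Icc lo hi, F q ≤ F p}

lemma maximizers_nonempty {lo hi : ℕ} (h : lo ≤ hi) (F : ℕ → ℤ) :
    (maximizers lo hi F).Nonempty := by
  obtain ⟨p, hp, hmax⟩ := (Icc lo hi).exists_max_image F ⟨lo, by simpa using h⟩
  exact ⟨p, hp, hmax⟩

lemma bddAbove_maximizers (lo hi : ℕ) (F : ℕ → ℤ) : BddAbove (maximizers lo hi F) :=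
  ⟨hi, fun _ hp => (mem_Icc.1 hp.1).2⟩

lemma sInf_mem_maximizers {lo hi : ℕ} (h : lo ≤ hi) (F : ℕ → ℤ) :
    sInf (maximizers lo hi F) ∈ maximizers lo hi F :=
  Nat.sInf_mem (maximizers_nonempty h F)

lemma sSup_mem_maximizers {lo hi : ℕ} (h : lo ≤ hi) (F : ℕ → ℤ) :
    sSup (maximizers lo hi F) ∈ maximizers lo hi F :=
  Nat.sSup_mem (maximizers_nonempty h F) (bddAbove_maximizers lo hi F)

lemma eq_of_mem_maximizers {lo hi : ℕ} {F : ℕ → ℤ} {p q : ℕ}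
    (hp : p ∈ maximizers lo hi F) (hq : q ∈ maximizers lo hi F) : F p = F q :=
  le_antisymm (hq.2 p hp.1) (hp.2 q hq.1)

lemma lt_of_lt_sInf_maximizers {lo hi : ℕ} {F : ℕ → ℤ} {q : ℕ} (hq : q ∈ Icc lo hi)
    (h : q < sInf (maximizers lo hi F)) : F q < F (sInf (maximizers lo hi F)) := by
  have hmem := sInf_mem_maximizers ((mem_Icc.1 hq).1.trans (mem_Icc.1 hq).2) F
  by_contra! hle
  exact Nat.notMem_of_lt_sInf h ⟨hq, fun r hr => (hmem.2 r hr).trans hle⟩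

lemma lt_of_sSup_maximizers_lt {lo hi : ℕ} {F : ℕ → ℤ} {q : ℕ} (hq : q ∈ Icc lo hi)
    (h : sSup (maximizers lo hi F) < q) : F q < F (sSup (maximizers lo hi F)) := by
  have hmem := sSup_mem_maximizers ((mem_Icc.1 hq).1.trans (mem_Icc.1 hq).2) F
  by_contra! hle
  exact h.not_ge (le_csSup (bddAbove_maximizers lo hi F)
    ⟨hq, fun r hr => (hmem.2 r hr).trans hle⟩)

/-- The sum over the path that follows `x` up to `p` and `y` from `p` on. -/
def pathSum (lo hi : ℕ) (x y : ℕ → ℤ) (p : ℕ) : ℤ :=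
  ∑ j ∈ Icc lo p, x j + ∑ j ∈ Icc p hi, y j

lemma sum_Icc_add_single (lo hi p : ℕ) (x : ℕ → ℤ) (c : ℤ) :
    ∑ j ∈ Icc lo hi, (x j + if j = p then c else 0) =
      ∑ j ∈ Icc lo hi, x j + if lo ≤ p ∧ p ≤ hi then c else 0 := by
  simp [sum_add_distrib]

lemma sum_Icc_pred_add_sum_Icc {lo hi p : ℕ} (hlo : 1 ≤ lo) (hp : p ∈ Icc lo hi) (x : ℕ → ℤ) :
    ∑ j ∈ Icc lo (p - 1), x j + ∑ j ∈ Icc p hi, x j = ∑ j ∈ Icc lo hi, x j := by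
  rw [mem_Icc] at hp
  rw [← sum_union (disjoint_left.2 fun j => by simp only [mem_Icc]; omega)]
  congr 1
  ext j
  simp only [mem_union, mem_Icc]
  omega

lemma pathSum_sub_sum_right {lo hi p : ℕ} (hlo : 1 ≤ lo) (hp : p ∈ Icc lo hi) (x y : ℕ → ℤ) :
    pathSum lo hi x y p - ∑ j ∈ Icc lo hi, y j =
      ∑ j ∈ Icc lo p, x j - ∑ j ∈ Icc lo (p - 1), y j := by
  rw [pathSum, ← sum_Icc_pred_add_sum_Icc hlo hp y]
  ring

lemma pathSum_sub_sum_left {lo hi p : ℕ} (hp : p ∈ Icc lo hi) (x y : ℕ → ℤ) :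
    pathSum lo hi x y p - ∑ j ∈ Icc lo hi, x j =
      ∑ j ∈ Icc p hi, y j - ∑ j ∈ Icc (p + 1) hi, x j := by
  have h : ∑ j ∈ Icc lo p, x j + ∑ j ∈ Icc (p + 1) hi, x j = ∑ j ∈ Icc lo hi, x j := by
    rw [mem_Icc] at hp
    rw [← sum_union (disjoint_left.2 fun j => by simp only [mem_Icc]; omega)]
    congr 1
    ext j
    simp only [mem_union, mem_Icc]
    omega
  rw [pathSum, ← h]
  ring

/-- The effect on path sums of moving `c` from `y p` to `x p`. -/
lemma pathSum_transfer {lo hi p q : ℕ} (hp : p ∈ Icc lo hi) (x y : ℕ → ℤ) (c : ℤ) :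
    pathSum lo hi (fun j => x j + if j = p then c else 0)
        (fun j => y j + if j = p then -c else 0) q =
      pathSum lo hi x y q + (if p ≤ q then c else 0) + (if q ≤ p then -c else 0) := by
  rw [mem_Icc] at hp
  simp only [pathSum, sum_Icc_add_single, hp.1, hp.2, true_and, and_true]
  ring

lemma sInf_mem_maximizers_transfer {lo hi : ℕ} (h : lo ≤ hi) (x y : ℕ → ℤ) {p : ℕ}
    {c : ℤ} (hp : p = sInf (maximizers lo hi (pathSum lo hi x y))) (hc : c = -1) :
    p ∈ maximizers lo hi (pathSum lo hi (fun j => x j + if j = p then c else 0)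
      (fun j => y j + if j = p then -c else 0)) := by
  have hmem := sInf_mem_maximizers h (pathSum lo hi x y)
  rw [← hp] at hmem
  refine ⟨hmem.1, fun q hq => ?_⟩
  have hle := hmem.2 q hq
  have hlt := lt_of_lt_sInf_maximizers (F := pathSum lo hi x y) hq
  rw [← hp] at hlt
  simp only [pathSum_transfer hmem.1, le_refl, if_true]
  split_ifs <;> omega

lemma sSup_mem_maximizers_transfer {lo hi : ℕ} (h : lo ≤ hi) (x y : ℕ → ℤ) {p : ℕ}
    {c : ℤ} (hp : p = sSup (maximizers lo hi (pathSum lo hi x y))) (hc : c = 1) :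
    p ∈ maximizers lo hi (pathSum lo hi (fun j => x j + if j = p then c else 0)
      (fun j => y j + if j = p then -c else 0)) := by
  have hmem := sSup_mem_maximizers h (pathSum lo hi x y)
  rw [← hp] at hmem
  refine ⟨hmem.1, fun q hq => ?_⟩
  have hle := hmem.2 q hq
  have hlt := lt_of_sSup_maximizers_lt (F := pathSum lo hi x y) hq
  rw [← hp] at hlt
  simp only [pathSum_transfer hmem.1, le_refl, if_true]
  split_ifs <;> omega

/-! ### `φ_l` and `ε_l` through an arbitrary maximizer -/

section Maximizer

variable {n i l : ℕ} {A : Arr} {p : ℕ}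

lemma phi_of_gt (m : ℕ) (hl : i < l)
    (hp : p ∈ maximizers 1 i (pathSum 1 i (fun j => A j (l - 1)) fun j => A j l)) :
    phi n i m l A =
      pathSum 1 i (fun j => A j (l - 1)) (fun j => A j l) p - ∑ j ∈ Icc 1 i, A j l := by
  have h1 := mem_Icc.1 hp.1
  have hmem : pplus i A l ∈ maximizers 1 i (pathSum 1 i (fun j => A j (l - 1)) fun j => A j l) :=
    sInf_mem_maximizers (h1.1.trans h1.2) _
  rw [phi, if_neg hl.ne', if_pos hl, eq_of_mem_maximizers hp hmem,
    pathSum_sub_sum_right le_rfl hmem.1]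

lemma eps_of_gt (m : ℕ) (hl : i < l)
    (hp : p ∈ maximizers 1 i (pathSum 1 i (fun j => A j (l - 1)) fun j => A j l)) :
    eps n i m l A =
      pathSum 1 i (fun j => A j (l - 1)) (fun j => A j l) p - ∑ j ∈ Icc 1 i, A j (l - 1) := by
  have h1 := mem_Icc.1 hp.1
  have hmem : qplus i A l ∈ maximizers 1 i (pathSum 1 i (fun j => A j (l - 1)) fun j => A j l) :=
    sSup_mem_maximizers (h1.1.trans h1.2) _
  rw [eps, if_neg hl.ne', if_pos hl, eq_of_mem_maximizers hp hmem,
    pathSum_sub_sum_left hmem.1]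

lemma phi_of_lt (m : ℕ) (hl : l < i)
    (hp : p ∈ maximizers i n (pathSum i n (A l) (A (l + 1)))) :
    phi n i m l A = pathSum i n (A l) (A (l + 1)) p - ∑ j ∈ Icc i n, A l j := by
  have h1 := mem_Icc.1 hp.1
  have hmem : pminus n i A l ∈ maximizers i n (pathSum i n (A l) (A (l + 1))) :=
    sSup_mem_maximizers (h1.1.trans h1.2) _
  rw [phi, if_neg hl.ne, if_neg hl.not_gt, eq_of_mem_maximizers hp hmem,
    pathSum_sub_sum_left hmem.1]

lemma eps_of_lt (m : ℕ) (hl : l < i)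
    (hp : p ∈ maximizers i n (pathSum i n (A l) (A (l + 1)))) :
    eps n i m l A = pathSum i n (A l) (A (l + 1)) p - ∑ j ∈ Icc i n, A (l + 1) j := by
  have h1 := mem_Icc.1 hp.1
  have hmem : qminus n i A l ∈ maximizers i n (pathSum i n (A l) (A (l + 1))) :=
    sInf_mem_maximizers (h1.1.trans h1.2) _
  rw [eps, if_neg hl.ne, if_neg hl.not_gt, eq_of_mem_maximizers hp hmem,
    pathSum_sub_sum_right (by omega) hmem.1]

end Maximizer

/-! ### Weights of updated arrays -/

lemma wtv_upd {n i p q : ℕ} (m : ℕ) (A : Arr) (v : ℤ) (hp : p ∈ Icc 1 i) (hq : q ∈ Icc i n)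
    (j : ℕ) :
    wtv n i m (upd A p q v) j = wtv n i m A j - (v - A p q) * ∑ r ∈ Icc p q, cart j r := by
  have key : ∀ p' q', upd A p q v p' q' * ∑ r ∈ Icc p' q', cart j r =
      A p' q' * ∑ r ∈ Icc p' q', cart j r +
        if p' = p then if q' = q then (v - A p q) * ∑ r ∈ Icc p q, cart j r else 0 else 0 := by
    intro p' q'
    by_cases h1 : p' = p <;> by_cases h2 : q' = q <;> simp [upd, h1, h2]
    ring
  have hpull : ∀ p', ∑ q' ∈ Icc i n, (if p' = p then
      if q' = q then (v - A p q) * ∑ r ∈ Icc p q, cart j r else 0 else 0) =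
      if p' = p then (v - A p q) * ∑ r ∈ Icc p q, cart j r else 0 := by
    intro p'
    split_ifs
    · rw [sum_ite_eq', if_pos hq]
    · simp
  simp only [wtv, key, sum_add_distrib, hpull]
  rw [sum_ite_eq', if_pos hp]
  ring

/-! ### Transferring an amount `c` between adjacent rows or columns, or into `a_{i,i}` -/

/-- `B` relates to `A` as `e_l^c A` should. -/
def ShiftedBy (n i m l : ℕ) (A B : Arr) (c : ℤ) : Prop :=
  (∀ j, wtv n i m B j = wtv n i m A j + c * cart j l) ∧
    eps n i m l B = eps n i m l A - c ∧ phi n i m l B = phi n i m l A + c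

lemma shiftedBy_diag {n i : ℕ} (m : ℕ) (hi : 1 ≤ i) (hin : i ≤ n) (A : Arr) (c : ℤ) :
    ShiftedBy n i m i A (upd A i i (A i i - c)) c := by
  refine ⟨fun j => ?_, by simp [eps, upd], ?_⟩
  · rw [wtv_upd m A _ (by simp [hi]) (by simp [hin])]
    simp
  · have h1 : ∑ j ∈ Icc 1 (i - 1), upd A i i (A i i - c) j i = ∑ j ∈ Icc 1 (i - 1), A j i :=
      sum_congr rfl fun j hj => by
        rw [mem_Icc] at hj
        rw [upd, if_neg (by omega)]
    have h2 : ∀ j, upd A i i (A i i - c) i j = A i j + if j = i then -c else 0 := by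
      intro j
      by_cases h : j = i <;> simp [upd, h, sub_eq_add_neg]
    simp only [phi, if_true, h1, h2, sum_Icc_add_single, le_refl, hin, and_self]
    ring

lemma shiftedBy_rows {n i l p : ℕ} (m : ℕ) (hl : i < l) (hln : l ≤ n) (A : Arr) (c : ℤ)
    (hp : p ∈ maximizers 1 i (pathSum 1 i (fun j => A j (l - 1)) fun j => A j l))
    (hp' : p ∈ maximizers 1 i (pathSum 1 i (fun j => A j (l - 1) + if j = p then c else 0)
      fun j => A j l + if j = p then -c else 0)) :
    ShiftedBy n i m l A
      (upd (upd A p (l - 1) (A p (l - 1) + c)) p l (A p l - c)) c := by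
  set B := upd (upd A p (l - 1) (A p (l - 1) + c)) p l (A p l - c) with hB
  have hpi := mem_Icc.1 hp.1
  have hx : ∀ j, B j (l - 1) = A j (l - 1) + if j = p then c else 0 := by
    intro j
    have : l - 1 ≠ l := by omega
    by_cases h : j = p <;> simp [hB, upd, h, this]
  have hy : ∀ j, B j l = A j l + if j = p then -c else 0 := by
    intro j
    have : l ≠ l - 1 := by omega
    by_cases h : j = p <;> simp [hB, upd, h, this, sub_eq_add_neg]
  have hpB : p ∈ maximizers 1 i (pathSum 1 i (fun j => B j (l - 1)) fun j => B j l) := by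
    simpa only [hx, hy] using hp'
  refine ⟨fun j => ?_, ?_, ?_⟩
  · have hupd : upd A p (l - 1) (A p (l - 1) + c) p l = A p l := by
      simp [upd, show l ≠ l - 1 by omega]
    have hS : ∑ r ∈ Icc p l, cart j r = ∑ r ∈ Icc p (l - 1), cart j r + cart j l := by
      obtain ⟨k, rfl⟩ : ∃ k, l = k + 1 := ⟨l - 1, by omega⟩
      exact sum_Icc_succ_top (by omega) _
    rw [hB, wtv_upd m _ _ hp.1 (by simp; omega), wtv_upd m _ _ hp.1 (by simp; omega), hupd, hS]
    ring
  · rw [eps_of_gt m hl hpB, eps_of_gt m hl hp]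
    simp only [hx, hy, pathSum_transfer hp.1, sum_Icc_add_single, hpi, le_refl, and_self, if_true]
    ring
  · rw [phi_of_gt m hl hpB, phi_of_gt m hl hp]
    simp only [hx, hy, pathSum_transfer hp.1, sum_Icc_add_single, hpi, le_refl, and_self, if_true]
    ring

lemma shiftedBy_columns {n i l p : ℕ} (m : ℕ) (hl : l < i) (hl1 : 1 ≤ l) (A : Arr) (c : ℤ)
    (hp : p ∈ maximizers i n (pathSum i n (A l) (A (l + 1))))
    (hp' : p ∈ maximizers i n (pathSum i n (fun j => A l j + if j = p then -c else 0)
      fun j => A (l + 1) j + if j = p then - -c else 0)) :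
    ShiftedBy n i m l A
      (upd (upd A l p (A l p - c)) (l + 1) p (A (l + 1) p + c)) c := by
  set B := upd (upd A l p (A l p - c)) (l + 1) p (A (l + 1) p + c) with hB
  have hpi := mem_Icc.1 hp.1
  have hx : B l = fun j => A l j + if j = p then -c else 0 := by
    ext j
    by_cases h : j = p <;> simp [hB, upd, h, sub_eq_add_neg]
  have hy : B (l + 1) = fun j => A (l + 1) j + if j = p then - -c else 0 := by
    ext j
    by_cases h : j = p <;> simp [hB, upd, h]
  have hpB : p ∈ maximizers i n (pathSum i n (B l) (B (l + 1))) := by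
    rwa [hx, hy]
  refine ⟨fun j => ?_, ?_, ?_⟩
  · have hupd : upd A l p (A l p - c) (l + 1) p = A (l + 1) p := by
      simp [upd]
    have hS : ∑ r ∈ Icc l p, cart j r = cart j l + ∑ r ∈ Icc (l + 1) p, cart j r := by
      rw [Icc_add_one_left_eq_Ioc, add_sum_Ioc_eq_sum_Icc (by omega)]
    rw [hB, wtv_upd m _ _ (by simp; omega) hp.1, wtv_upd m _ _ (by simp; omega) hp.1, hupd, hS]
    ring
  · rw [eps_of_lt m hl hpB, eps_of_lt m hl hp]
    simp only [hx, hy, pathSum_transfer hp.1, sum_Icc_add_single, hpi, le_refl, and_self, if_true]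
    ring
  · rw [phi_of_lt m hl hpB, phi_of_lt m hl hp]
    simp only [hx, hy, pathSum_transfer hp.1, sum_Icc_add_single, hpi, le_refl, and_self, if_true]
    ring

lemma shiftedBy_eop {n i m l : ℕ} (hi : 1 ≤ i) (hin : i ≤ n) (hl : l ∈ Icc 1 n) {A B : Arr}
    (h : eop n i m l A = some B) : ShiftedBy n i m l A B 1 := by
  rw [mem_Icc] at hl
  simp only [eop, Option.ite_none_left_eq_some, Option.some.injEq] at h
  obtain ⟨-, rfl⟩ := h
  rcases lt_trichotomy l i with hli | rfl | hli
  · rw [if_neg hli.ne, if_neg hli.not_gt]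
    exact shiftedBy_columns m hli hl.1 A 1 (sInf_mem_maximizers hin _)
      (sInf_mem_maximizers_transfer hin _ _ rfl (by norm_num))
  · rw [if_pos rfl]
    exact shiftedBy_diag m hi hin A 1
  · rw [if_neg hli.ne', if_pos hli]
    exact shiftedBy_rows m hli hl.2 A 1 (sSup_mem_maximizers hi _)
      (sSup_mem_maximizers_transfer hi _ _ rfl (by norm_num))

lemma shiftedBy_fop {n i m l : ℕ} (hi : 1 ≤ i) (hin : i ≤ n) (hl : l ∈ Icc 1 n) {A B : Arr}
    (h : fop n i m l A = some B) : ShiftedBy n i m l A B (-1) := by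
  rw [mem_Icc] at hl
  simp only [fop, Option.ite_none_left_eq_some, Option.some.injEq] at h
  obtain ⟨-, rfl⟩ := h
  rcases lt_trichotomy l i with hli | rfl | hli
  · rw [if_neg hli.ne, if_neg hli.not_gt]
    simpa only [sub_neg_eq_add, ← sub_eq_add_neg] using
      shiftedBy_columns (p := pminus n i A l) m hli hl.1 A (-1) (sSup_mem_maximizers hin _)
        (sSup_mem_maximizers_transfer hin _ _ rfl (by norm_num))
  · rw [if_pos rfl]
    simpa only [sub_neg_eq_add] using shiftedBy_diag m hi hin A (-1)
  · rw [if_neg hli.ne', if_pos hli]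
    simpa only [sub_neg_eq_add, ← sub_eq_add_neg] using
      shiftedBy_rows (p := pplus i A l) m hli hl.2 A (-1) (sInf_mem_maximizers hi _)
        (sInf_mem_maximizers_transfer hi _ _ rfl (by norm_num))

/-- Behaviour of `wt`, `ε_l`, `φ_l` under the Kashiwara operators:
if `e_l A ≠ 0` then `wt(e_l A) = wt(A) + α_l`, `ε_l(e_l A) = ε_l(A) − 1` and
`φ_l(e_l A) = φ_l(A) + 1`; dually for `f_l`. -/
theorem stmt6 (n i m : ℕ) (hi : 1 ≤ i) (hin : i ≤ n) (A : Arr) (hA : InB n i m A)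
    (l : ℕ) (hl : l ∈ Finset.Icc 1 n) :
    (∀ B, eop n i m l A = some B →
      (∀ j, wtv n i m B j = wtv n i m A j + cart j l) ∧
      eps n i m l B = eps n i m l A - 1 ∧ phi n i m l B = phi n i m l A + 1) ∧
    (∀ B, fop n i m l A = some B →
      (∀ j, wtv n i m B j = wtv n i m A j - cart j l) ∧
      eps n i m l B = eps n i m l A + 1 ∧ phi n i m l B = phi n i m l A - 1) := by
  refine ⟨fun B hB => ?_, fun B hB => ?_⟩
  · simpa [ShiftedBy] using shiftedBy_eop hi hin hl hB
  · simpa [ShiftedBy, ← sub_eq_add_neg] using shiftedBy_fop hi hin hl hB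

end KR
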